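/- Every looped chain graph is a big face graph: in any planar embedding of a looped chain of genus g+1, there is a bounded face that shares an edge with every other bounded face. -/

import Mathlib

/-- A multigraph with vertex type `V` and edge type `E`, each edge having an ordered
pair of endpoints, together with a (topological) embedding in the plane: vertices are
distinct points, edges are arcs joining their endpoints, with pairwise disjoint
interiors avoiding the vertices. -/
structure PlaneEmbedding (V E : Type) (ends : E → V × V) where
  vpos : V → ℝ × ℝ
  vinj : Function.Injective vpos
  arc : E → ℝ → ℝ × ℝ
  arc_cont : ∀ e, ContinuousOn (arc e) (Set.Icc 0 1)
  arc_src : ∀ e, arc e 0 = vpos (ends e).1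
  arc_tgt : ∀ e, arc e 1 = vpos (ends e).2
  arc_injOn : ∀ e, Set.InjOn (arc e) (Set.Ioo 0 1)
  arc_disjoint : ∀ e e', e ≠ e' →
    Disjoint (arc e '' Set.Ioo 0 1) (arc e' '' Set.Ioo 0 1)
  arc_avoid : ∀ e v, vpos v ∉ arc e '' Set.Ioo 0 1

/-- The image of the embedded graph in the plane. -/
def PlaneEmbedding.image {V E : Type} {ends : E → V × V}
    (emb : PlaneEmbedding V E ends) : Set (ℝ × ℝ) :=
  Set.range emb.vpos ∪ ⋃ e, emb.arc e '' Set.Icc 0 1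

/-- A face of the embedding: a connected component of the complement of the image. -/
def PlaneEmbedding.IsFace {V E : Type} {ends : E → V × V}
    (emb : PlaneEmbedding V E ends) (F : Set (ℝ × ℝ)) : Prop :=
  ∃ p ∉ emb.image, F = connectedComponentIn emb.imageᶜ p

/-- A bounded face of the embedding. -/
def PlaneEmbedding.IsBoundedFace {V E : Type} {ends : E → V × V}
    (emb : PlaneEmbedding V E ends) (F : Set (ℝ × ℝ)) : Prop :=
  emb.IsFace F ∧ Bornology.IsBounded F

/-- Two faces share an edge if the (open) arc of some edge lies on the frontier of both. -/
def PlaneEmbedding.SharesEdge {V E : Type} {ends : E → V × V}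
    (emb : PlaneEmbedding V E ends) (F F' : Set (ℝ × ℝ)) : Prop :=
  ∃ e : E, emb.arc e '' Set.Ioo 0 1 ⊆ frontier F ∧ emb.arc e '' Set.Ioo 0 1 ⊆ frontier F'

/-- Vertices of the looped chain built on `m+1` joints (chain of genus `m+2`, looped
chain of genus `m+3`): the two resolved 3-valent vertices `(j,false)`, `(j,true)` at each
joint `j`, plus the two subdivision vertices (`Sum.inr false` on the first cycle and
`Sum.inr true` on the last cycle) of the added connecting edge. -/
abbrev LoopedChainV (m : ℕ) := (Fin (m + 1) × Bool) ⊕ Bool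

/-- Edges of the looped chain: the `m+1` joint edges; two edges for each of the `m`
interior cycles; the two halves of the (subdivided) first-cycle edge; the two halves of
the (subdivided) last-cycle edge; and the added connecting edge. -/
abbrev LoopedChainE (m : ℕ) :=
  Fin (m + 1) ⊕ ((Fin m × Bool) ⊕ (Bool ⊕ (Bool ⊕ Unit)))

/-- Endpoints of the edges of the looped chain determined by the resolution choices
`c : Fin (m+1) → Bool` at the joints: `c j = false` is the resolution where the two
cycles meeting at joint `j` each attach to both vertices `(j,false)`, `(j,true)`;
`c j = true` is the resolution where the left cycle attaches twice to `(j,false)` and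
the right cycle twice to `(j,true)`. -/
def loopedChainEnds (m : ℕ) (c : Fin (m + 1) → Bool) :
    LoopedChainE m → LoopedChainV m × LoopedChainV m
  | .inl j => (.inl (j, false), .inl (j, true))
  | .inr (.inl (k, s)) =>
      (.inl (k.castSucc, if c k.castSucc then true else s),
       .inl (k.succ, if c k.succ then false else s))
  | .inr (.inr (.inl s)) => (.inr false, .inl (0, if c 0 then false else s))
  | .inr (.inr (.inr (.inl s))) =>
      (.inr true, .inl (Fin.last m, if c (Fin.last m) then true else s))
  | .inr (.inr (.inr (.inr _))) => (.inr false, .inr true)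

namespace LoopedChain

open Set Topology



/-- Homotopy lifting through the exponential. -/
lemma exists_log_of_homotopy {A : Type*} [TopologicalSpace A] (H : unitInterval × A → ℂ)
    (hc : Continuous H) (hne : ∀ x, H x ≠ 0) (h0 : ∀ a, H (0, a) = 1) :
    ∃ G : A → ℂ, Continuous G ∧ ∀ a, Complex.exp (G a) = H (1, a) := by
  let H' : C(unitInterval × A, {z : ℂ // z ≠ 0}) :=
    ⟨fun x => ⟨H x, hne x⟩, hc.subtype_mk _⟩
  have hH0 : ∀ a, H' (0, a) =
      (fun z : ℂ ↦ (⟨_, z.exp_ne_zero⟩ : {z : ℂ // z ≠ 0})) ((ContinuousMap.const A (0:ℂ)) a) := by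
    intro a
    apply Subtype.ext
    simp [H', h0]
  let L := Complex.isCoveringMap_exp.liftHomotopy H' (ContinuousMap.const A 0) hH0
  have hL := Complex.isCoveringMap_exp.liftHomotopy_lifts H' (ContinuousMap.const A 0) hH0
  refine ⟨fun a => L (1, a), by fun_prop, fun a => ?_⟩
  have := congrArg Subtype.val (congrFun hL (1, a))
  exact this

lemma exists_log_plane (g : ℂ → ℂ) (hc : Continuous g) (hne : ∀ z, g z ≠ 0) :
    ∃ G : ℂ → ℂ, Continuous G ∧ ∀ z, Complex.exp (G z) = g z := by
  obtain ⟨G, hG, hG'⟩ := exists_log_of_homotopy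
    (fun x : unitInterval × ℂ => g ((x.1 : ℝ) * x.2) / g 0) (by
      have := hne 0
      fun_prop (disch := simpa)) (fun x => div_ne_zero (hne _) (hne _)) (by
      intro a; simp [div_self (hne 0)])
  refine ⟨fun z => G z + Complex.log (g 0), by fun_prop, fun z => ?_⟩
  rw [Complex.exp_add, Complex.exp_log (hne 0), hG']
  simp [div_mul_cancel₀ _ (hne 0)]

lemma exists_log_path (g : ℝ → ℂ) (hc : ContinuousOn g (Icc 0 1)) (hne : ∀ t ∈ Icc (0:ℝ) 1, g t ≠ 0) :
    ∃ G : ℝ → ℂ, ContinuousOn G (Icc 0 1) ∧ ∀ t ∈ Icc (0:ℝ) 1, Complex.exp (G t) = g t := by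
  have h01 : (0:ℝ) ∈ Icc (0:ℝ) 1 := by simp
  have hmem : ∀ x : unitInterval × unitInterval, (x.1 : ℝ) * x.2 ∈ Icc (0:ℝ) 1 := fun x => (x.1 * x.2).2
  obtain ⟨G, hG, hG'⟩ := exists_log_of_homotopy
    (fun x : unitInterval × unitInterval => g ((x.1 : ℝ) * x.2) / g 0) (by
      refine Continuous.div_const ?_ _
      exact hc.comp_continuous (by fun_prop) hmem)
    (fun x => div_ne_zero (hne _ (hmem x)) (hne _ h01)) (by
      intro a; simp [div_self (hne 0 h01)])
  refine ⟨fun t => G (projIcc 0 1 zero_le_one t) + Complex.log (g 0), by fun_prop, fun t ht => ?_⟩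
  rw [Complex.exp_add, Complex.exp_log (hne 0 h01), hG']
  simp [div_mul_cancel₀ _ (hne 0 h01), projIcc_of_mem _ ht]

/-- In the complement of an arc, `(z - γ 1) / (z - γ 0)` has a logarithm. -/
lemma exists_log_compl_arc (γ : ℝ → ℂ) (hc : ContinuousOn γ (Icc 0 1)) :
    ∃ G : ℂ → ℂ, ContinuousOn G (γ '' Icc 0 1)ᶜ ∧
      ∀ z ∈ (γ '' Icc 0 1)ᶜ, z - γ 1 = (z - γ 0) * Complex.exp (G z) := by
  classical
  have hne : ∀ (z : ((γ '' Icc 0 1)ᶜ : Set ℂ)) (t : unitInterval), (z : ℂ) - γ t ≠ 0 := by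
    intro z t h
    exact z.2 ⟨t, t.2, (sub_eq_zero.mp h).symm⟩
  have h00 : ∀ z : ((γ '' Icc 0 1)ᶜ : Set ℂ), (z : ℂ) - γ 0 ≠ 0 := fun z => hne z 0
  have hγ : Continuous (fun t : unitInterval => γ t) := hc.comp_continuous (by fun_prop) (fun t => t.2)
  obtain ⟨G, hG, hG'⟩ := exists_log_of_homotopy
    (fun x : unitInterval × ((γ '' Icc 0 1)ᶜ : Set ℂ) => ((x.2 : ℂ) - γ x.1) / (x.2 - γ 0)) (by
      refine Continuous.div ?_ (by fun_prop) (fun x => h00 x.2)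
      exact (continuous_subtype_val.comp continuous_snd).sub (hγ.comp continuous_fst))
    (fun x => div_ne_zero (hne _ _) (h00 _)) (by
      intro a; simp [div_self (h00 a)])
  refine ⟨fun z => if h : z ∈ (γ '' Icc 0 1)ᶜ then G ⟨z, h⟩ else 0, ?_, ?_⟩
  · rw [continuousOn_iff_continuous_domRestrict]
    convert hG using 1
    ext z
    simp only [domRestrict_apply]
    rw [dif_pos z.2]
  · intro z hz
    simp only [dif_pos hz, hG']
    have := h00 ⟨z, hz⟩
    simp only at this
    field_simp
    simp

lemma exp_eq_one_const {A : Type*} [TopologicalSpace A] {S : Set A} (hS : IsPreconnected S)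
    {f : A → ℂ} (hf : ContinuousOn f S) (h1 : ∀ x ∈ S, Complex.exp (f x) = 1) {x y : A}
    (hx : x ∈ S) (hy : y ∈ S) : f x = f y := by
  have him : IsPreconnected (f '' S) := hS.image f hf
  have hsub : f '' S ⊆ Set.range (fun n : ℤ => (n : ℂ) * (2 * Real.pi * Complex.I)) := by
    rintro _ ⟨z, hz, rfl⟩
    obtain ⟨n, hn⟩ := Complex.exp_eq_one_iff.mp (h1 z hz)
    exact ⟨n, hn.symm⟩
  have hcount : (f '' S).Countable := (Set.countable_range _).mono hsub
  exact hcount.isTotallyDisconnected _ (Subset.refl _) him ⟨x, hx, rfl⟩ ⟨y, hy, rfl⟩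

lemma no_log_circle (p : ℂ) (r : ℝ) (hr : 0 < r) (G : ℂ → ℂ)
    (hG : ContinuousOn G (Metric.sphere p r))
    (h : ∀ z ∈ Metric.sphere p r, Complex.exp (G z) = z - p) : False := by
  have hm : ∀ θ : ℝ, p + r * Complex.exp (θ * Complex.I) ∈ Metric.sphere p r := by
    intro θ
    simp [Complex.norm_exp_ofReal_mul_I, abs_of_pos hr]
  have hr' : (r : ℂ) ≠ 0 := by exact_mod_cast hr.ne'
  have hc : ContinuousOn (fun θ : ℝ => G (p + r * Complex.exp (θ * Complex.I))
      - (θ * Complex.I + Complex.log r)) univ := by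
    rw [continuousOn_univ]
    refine Continuous.sub ?_ (by fun_prop)
    exact hG.comp_continuous (by fun_prop) hm
  have := exp_eq_one_const isPreconnected_univ hc (fun θ _ => by
    rw [Complex.exp_sub, h _ (hm θ), Complex.exp_add, Complex.exp_log hr']
    have := Complex.exp_ne_zero (θ * Complex.I)
    field_simp
    ring) (mem_univ 0) (mem_univ (2 * Real.pi))
  simp [Complex.exp_two_pi_mul_I, Real.pi_ne_zero] at this

lemma mem_slit {a b : ℂ} (h : ‖a - b‖ < ‖b‖) : a / b ∈ Complex.slitPlane := by
  have hb : b ≠ 0 := by rintro rfl; simp at h; exact absurd h (not_lt.mpr (norm_nonneg _))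
  have : ‖a / b - 1‖ < 1 := by
    rw [div_sub_one hb, norm_div, div_lt_one (norm_pos_iff.mpr hb)]; exact h
  left
  have h2 := Complex.abs_re_le_norm (a / b - 1)
  have h3 := abs_lt.mp (h2.trans_lt this)
  simp only [Complex.sub_re, Complex.one_re] at h3
  linarith [h3.1]

lemma no_log_two (a b : ℂ) (hab : a ≠ b) (G : ℂ → ℂ) (hG : ContinuousOn G {a, b}ᶜ)
    (h : ∀ z ∈ ({a, b}ᶜ : Set ℂ), z - b = (z - a) * Complex.exp (G z)) : False := by
  set r := ‖a - b‖ / 2 with hr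
  have hpos : 0 < ‖a - b‖ := norm_pos_iff.mpr (sub_ne_zero.mpr hab)
  have key : ∀ z ∈ Metric.sphere a r, z ∈ ({a, b}ᶜ : Set ℂ) ∧ ‖(z - b) - (a - b)‖ < ‖a - b‖ := by
    intro z hz
    have hz' : ‖z - a‖ = r := by simpa [dist_eq_norm] using hz
    refine ⟨?_, by rw [sub_sub_sub_cancel_right, hz']; linarith⟩
    simp only [mem_compl_iff, mem_insert_iff, mem_singleton_iff, not_or]
    constructor
    · rintro rfl; simp at hz'; linarith
    · rintro rfl; rw [norm_sub_rev] at hz'; linarith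
  have hab' : a - b ≠ 0 := sub_ne_zero.mpr hab
  refine no_log_circle a r (by linarith) (fun z => Complex.log ((z - b) / (a - b)) +
    Complex.log (a - b) - G z) ?_ ?_
  · refine ContinuousOn.sub (ContinuousOn.add (ContinuousOn.clog ?_ ?_) continuousOn_const) ?_
    · fun_prop
    · intro z hz
      exact mem_slit (key z hz).2
    · exact hG.mono fun z hz => (key z hz).1
  · intro z hz
    have hz1 := (key z hz).1
    have hzb : z - b ≠ 0 := by
      intro h0; apply hz1; simp [sub_eq_zero.mp h0]
    rw [Complex.exp_sub, Complex.exp_add, Complex.exp_log hab', Complex.exp_log (div_ne_zero hzb hab'),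
      div_mul_cancel₀ _ hab', h z hz1]
    field_simp [Complex.exp_ne_zero]

/-- The identification of the plane with the complex numbers. -/
noncomputable def phi : ℝ × ℝ ≃ₜ ℂ := Complex.equivRealProdCLM.symm.toHomeomorph

lemma isBounded_phi_image {T : Set (ℝ × ℝ)} (hb : Bornology.IsBounded T) :
    Bornology.IsBounded (phi '' T) :=
  (Complex.equivRealProdCLM.symm : ℝ × ℝ →L[ℝ] ℂ).lipschitz.isBounded_image hb

/-- Eilenberg's criterion. -/
lemma no_log_frontier (T : Set (ℝ × ℝ)) (hb : Bornology.IsBounded T) (p q : ℝ × ℝ)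
    (hp : p ∈ T) (hq : q ∉ closure T) (f : C(frontier T, ℂ))
    (h : ∀ z : frontier T, phi z - phi p = (phi z - phi q) * Complex.exp (f z)) : False := by
  classical
  obtain ⟨F, hF⟩ := ContinuousMap.exists_restrict_eq (isClosed_frontier (s := T)) f
  have hF' : ∀ z (hz : z ∈ frontier T), F z = f ⟨z, hz⟩ := by
    intro z hz
    rw [← hF]; rfl
  let g : ℝ × ℝ → ℂ := fun z => if z ∈ T then (phi z - phi q) * Complex.exp (F z) else phi z - phi p
  have hphi := phi.continuous
  have hg : Continuous g := by
    refine Continuous.if ?_ (by fun_prop) (by fun_prop)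
    intro z hz
    have hz' : z ∈ frontier T := hz
    rw [hF' z hz', ← h ⟨z, hz'⟩]
  have hgne : ∀ z, g z ≠ 0 := by
    intro z
    by_cases hz : z ∈ T
    · simp only [g, if_pos hz]
      refine mul_ne_zero (sub_ne_zero.mpr fun heq => ?_) (Complex.exp_ne_zero _)
      obtain rfl := phi.injective heq
      exact hq (subset_closure hz)
    · simp only [g, if_neg hz]
      refine sub_ne_zero.mpr fun heq => ?_
      obtain rfl := phi.injective heq
      exact hz hp
  obtain ⟨G, hG, hG'⟩ := exists_log_plane (fun z => g (phi.symm z))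
    (hg.comp phi.symm.continuous) (fun z => hgne _)
  obtain ⟨R, hR⟩ := (isBounded_phi_image hb).subset_ball (phi p)
  have hR0 : 0 < R := by
    have := hR ⟨p, hp, rfl⟩
    simpa using this
  refine no_log_circle (phi p) R hR0 G hG.continuousOn ?_
  intro z hz
  rw [hG']
  have : phi.symm z ∉ T := fun hzT => by
    have := hR ⟨_, hzT, rfl⟩
    rw [phi.apply_symm_apply, Metric.mem_ball] at this
    rw [Metric.mem_sphere] at hz
    linarith
  simp [g, this]

/-- An arc contains no disc. -/
lemma arc_no_ball (γ : ℝ → ℂ) (hc : ContinuousOn γ (Icc 0 1)) (hi : InjOn γ (Icc 0 1))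
    (c : ℂ) (r : ℝ) (hr : 0 < r) (h : Metric.ball c r ⊆ γ '' Ioo 0 1) : False := by
  obtain ⟨u, hu, huc⟩ := h (Metric.mem_ball_self hr)
  have hu' : u ∈ Icc (0:ℝ) 1 := Ioo_subset_Icc_self hu
  have hd0 : 0 < dist (γ 0) c := by
    rw [dist_pos, ← huc]
    intro h0
    have := hi (by simp) hu' h0
    linarith [hu.1]
  have hd1 : 0 < dist (γ 1) c := by
    rw [dist_pos, ← huc]
    intro h0
    have := hi (by simp) hu' h0
    linarith [hu.2]
  obtain ⟨ρ, hρ0, hρ⟩ := exists_between (lt_min hr (lt_min hd0 hd1))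
  obtain ⟨hρr, hρ'⟩ := lt_min_iff.mp hρ
  obtain ⟨hρ1, hρ2⟩ := lt_min_iff.mp hρ'
  have hsA : Icc 0 u ⊆ Icc (0:ℝ) 1 := Icc_subset_Icc_right hu'.2
  have hsB : Icc u 1 ⊆ Icc (0:ℝ) 1 := Icc_subset_Icc_left hu'.1
  have hA : IsClosed (γ '' Icc 0 u) := (isCompact_Icc.image_of_continuousOn (hc.mono hsA)).isClosed
  have hB : IsClosed (γ '' Icc u 1) := (isCompact_Icc.image_of_continuousOn (hc.mono hsB)).isClosed
  have hS : IsPreconnected (Metric.sphere c ρ) := isPreconnected_sphere (by simp) c ρ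
  have hdist : ContinuousOn (fun t => dist (γ t) c) (Icc 0 1) := by fun_prop
  obtain ⟨x, hx, hxA, hxB⟩ := isPreconnected_closed_iff.mp hS _ _ hA hB (by
      intro x hx
      obtain ⟨t, ht, rfl⟩ := h (Metric.sphere_subset_ball hρr hx)
      rcases le_total t u with htu | htu
      · exact Or.inl ⟨t, ⟨ht.1.le, htu⟩, rfl⟩
      · exact Or.inr ⟨t, ⟨htu, ht.2.le⟩, rfl⟩) (by
      obtain ⟨t, ht, hte⟩ := intermediate_value_Icc' hu'.1 (hdist.mono hsA)
        (show ρ ∈ Icc _ _ from ⟨by simp [huc, hρ0.le], hρ1.le⟩)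
      exact ⟨γ t, hte, t, ht, rfl⟩) (by
      obtain ⟨t, ht, hte⟩ := intermediate_value_Icc hu'.2 (hdist.mono hsB)
        (show ρ ∈ Icc _ _ from ⟨by simp [huc, hρ0.le], hρ2.le⟩)
      exact ⟨γ t, hte, t, ht, rfl⟩)
  obtain ⟨t, ht, rfl⟩ := hxA
  obtain ⟨t', ht', htt⟩ := hxB
  have := hi (hsB ht') (hsA ht) htt
  subst this
  have : t' = u := le_antisymm ht.2 ht'.1
  subst this
  rw [Metric.mem_sphere, huc, dist_self] at hx
  linarith

/-- Of two distinct components of the complement of a compact set, one is bounded. -/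
lemma bounded_or_bounded (X : Set (ℝ × ℝ)) (hX : Bornology.IsBounded X) (p q : ℝ × ℝ)
    (hne : connectedComponentIn Xᶜ p ≠ connectedComponentIn Xᶜ q) :
    Bornology.IsBounded (connectedComponentIn Xᶜ p) ∨
      Bornology.IsBounded (connectedComponentIn Xᶜ q) := by
  by_contra hcon
  push Not at hcon
  obtain ⟨R, hR⟩ := (isBounded_phi_image hX).subset_closedBall 0
  let S : Set (ℝ × ℝ) := (fun x : ℝ × ℝ => phi.symm (x.1 * Complex.exp (x.2 * Complex.I))) ''
    (Ioi (max R 0) ×ˢ univ)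
  have hS : IsPreconnected S := by
    refine (isPreconnected_Ioi.prod isPreconnected_univ).image _ (Continuous.continuousOn ?_)
    exact phi.symm.continuous.comp (by fun_prop)
  have hSX : S ⊆ Xᶜ := by
    rintro _ ⟨⟨a, b⟩, ⟨ha, -⟩, rfl⟩ hx
    have h1 := hR ⟨_, hx, rfl⟩
    simp only [phi.apply_symm_apply, mem_closedBall_zero_iff, norm_mul,
      Complex.norm_exp_ofReal_mul_I, mul_one, Complex.norm_real, Real.norm_eq_abs] at h1
    have ha' : max R 0 < a := ha
    linarith [le_abs_self a, le_max_left R 0]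
  have hmeet : ∀ T : Set (ℝ × ℝ), ¬ Bornology.IsBounded T → ∃ x ∈ T, x ∈ S := by
    intro T hT
    by_contra hno
    push Not at hno
    apply hT
    have hb : Bornology.IsBounded (Complex.equivRealProdCLM '' Metric.closedBall (0:ℂ) (max R 0)) :=
      (Complex.equivRealProdCLM : ℂ →L[ℝ] ℝ × ℝ).lipschitz.isBounded_image Metric.isBounded_closedBall
    refine hb.subset fun x hx => ⟨phi x, ?_, ?_⟩
    · rw [mem_closedBall_zero_iff]
      by_contra hlt
      push Not at hlt
      refine hno x hx ⟨(‖phi x‖, (phi x).arg), ⟨hlt, mem_univ _⟩, ?_⟩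
      simp [Complex.norm_mul_exp_arg_mul_I]
    · exact Complex.equivRealProdCLM.apply_symm_apply x
  obtain ⟨x, hxp, hxS⟩ := hmeet _ hcon.1
  obtain ⟨y, hyq, hyS⟩ := hmeet _ hcon.2
  apply hne
  rw [connectedComponentIn_eq hxp, connectedComponentIn_eq hyq]
  exact connectedComponentIn_eq (hS.subset_connectedComponentIn hxS hSX hyS)

section General

variable {V E : Type} {ends : E → V × V}

lemma arc_mem_image (emb : PlaneEmbedding V E ends) (e : E) {t : ℝ} (ht : t ∈ Icc (0:ℝ) 1) :
    emb.arc e t ∈ emb.image :=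
  Or.inr (mem_iUnion.mpr ⟨e, t, ht, rfl⟩)

lemma vpos_mem_image (emb : PlaneEmbedding V E ends) (v : V) : emb.vpos v ∈ emb.image :=
  Or.inl ⟨v, rfl⟩

lemma isCompact_image [Finite V] [Finite E] (emb : PlaneEmbedding V E ends) :
    IsCompact emb.image :=
  (Set.finite_range _).isCompact.union
    (isCompact_iUnion fun e => isCompact_Icc.image_of_continuousOn (emb.arc_cont e))

lemma face_eq (emb : PlaneEmbedding V E ends) {T : Set (ℝ × ℝ)} (hT : emb.IsFace T) {p : ℝ × ℝ}
    (hp : p ∈ T) : T = connectedComponentIn emb.imageᶜ p := by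
  obtain ⟨q, hq, rfl⟩ := hT
  exact connectedComponentIn_eq hp

lemma face_disjoint (emb : PlaneEmbedding V E ends) {T : Set (ℝ × ℝ)} (hT : emb.IsFace T) {p : ℝ × ℝ}
    (hp : p ∈ T) : p ∉ emb.image := by
  obtain ⟨q, hq, rfl⟩ := hT
  exact connectedComponentIn_subset _ _ hp

lemma face_isOpen [Finite V] [Finite E] (emb : PlaneEmbedding V E ends) {T : Set (ℝ × ℝ)}
    (hT : emb.IsFace T) : IsOpen T := by
  obtain ⟨q, hq, rfl⟩ := hT
  exact (isCompact_image emb).isClosed.isOpen_compl.connectedComponentIn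

lemma face_frontier_subset [Finite V] [Finite E] (emb : PlaneEmbedding V E ends) {T : Set (ℝ × ℝ)}
    (hT : emb.IsFace T) : frontier T ⊆ emb.image := by
  intro x hx
  by_contra hxX
  have hO : IsOpen (connectedComponentIn emb.imageᶜ x) :=
    (isCompact_image emb).isClosed.isOpen_compl.connectedComponentIn
  have hxO : x ∈ connectedComponentIn emb.imageᶜ x := mem_connectedComponentIn hxX
  obtain ⟨y, hy, hyT⟩ := mem_closure_iff.mp hx.1 _ hO hxO
  have h1 := face_eq emb hT hyT
  rw [← connectedComponentIn_eq hy] at h1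
  apply hx.2
  rw [(face_isOpen emb hT).interior_eq, h1]
  exact hxO

lemma icc_cases {t : ℝ} (ht : t ∈ Icc (0:ℝ) 1) : t = 0 ∨ t = 1 ∨ t ∈ Ioo (0:ℝ) 1 := by
  rcases ht.1.eq_or_lt with h | h
  · exact Or.inl h.symm
  rcases ht.2.eq_or_lt with h' | h'
  · exact Or.inr (Or.inl h')
  · exact Or.inr (Or.inr ⟨h, h'⟩)

lemma no_potential [Finite V] [Finite E] (emb : PlaneEmbedding V E ends)
    (hV : ∀ v, ∃ e, (ends e).1 = v ∨ (ends e).2 = v) {T : Set (ℝ × ℝ)}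
    (hT : emb.IsBoundedFace T) {p q : ℝ × ℝ} (hp : p ∈ T) (hq : q ∉ emb.image) (hqT : q ∉ T)
    (l : E → ℝ → ℂ) (hlc : ∀ e, ContinuousOn (l e) (Icc 0 1))
    (hl : ∀ e, ∀ t ∈ Icc (0:ℝ) 1,
      phi (emb.arc e t) - phi p = (phi (emb.arc e t) - phi q) * Complex.exp (l e t))
    (lam : V → ℂ)
    (hlam : ∀ v, phi (emb.vpos v) - phi p = (phi (emb.vpos v) - phi q) * Complex.exp (lam v))
    (hcomp : ∀ e, emb.arc e '' Ioo 0 1 ⊆ frontier T →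
      l e 1 - l e 0 = lam (ends e).2 - lam (ends e).1) : False := by
  classical
  have hfr := face_frontier_subset emb hT.1
  have hqne : ∀ x ∈ emb.image, phi x - phi q ≠ 0 := by
    intro x hx h0
    have := phi.injective (sub_eq_zero.mp h0)
    exact hq (this ▸ hx)
  -- exponent comparison
  have hexp : ∀ x ∈ emb.image, ∀ a b : ℂ, phi x - phi p = (phi x - phi q) * Complex.exp a →
      phi x - phi p = (phi x - phi q) * Complex.exp b → Complex.exp a = Complex.exp b := by
    intro x hx a b ha hb
    exact mul_left_cancel₀ (hqne x hx) (ha.symm.trans hb)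
  have h0 : (0:ℝ) ∈ Icc (0:ℝ) 1 := by simp
  have h1 : (1:ℝ) ∈ Icc (0:ℝ) 1 := by simp
  have hsrc : ∀ e, Complex.exp (l e 0) = Complex.exp (lam (ends e).1) := by
    intro e
    refine hexp _ (vpos_mem_image emb (ends e).1) _ _ ?_ (hlam _)
    rw [← emb.arc_src]; exact hl e 0 h0
  have htgt : ∀ e, Complex.exp (l e 1) = Complex.exp (lam (ends e).2) := by
    intro e
    refine hexp _ (vpos_mem_image emb (ends e).2) _ _ ?_ (hlam _)
    rw [← emb.arc_tgt]; exact hl e 1 h1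
  have hcut : ∀ e, ∃ w : ℝ, w ∈ Ioo (0:ℝ) 1 ∧ (¬ emb.arc e '' Ioo 0 1 ⊆ frontier T →
      emb.arc e w ∉ frontier T) := by
    intro e
    by_cases h : emb.arc e '' Ioo 0 1 ⊆ frontier T
    · exact ⟨1/2, by norm_num, fun h' => absurd h h'⟩
    · rw [image_subset_iff, not_subset] at h
      obtain ⟨w, hw, hw'⟩ := h
      exact ⟨w, hw, fun _ => hw'⟩
  choose w hw hw' using hcut
  let g : E → ℝ → ℂ := fun e t =>
    if emb.arc e '' Ioo 0 1 ⊆ frontier T then l e t - l e 0 + lam (ends e).1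
    else if t < w e then l e t - l e 0 + lam (ends e).1 else l e t - l e 1 + lam (ends e).2
  have hg0 : ∀ e, g e 0 = lam (ends e).1 := by
    intro e
    simp only [g, (hw e).1, if_true]
    split_ifs <;> ring
  have hg1 : ∀ e, g e 1 = lam (ends e).2 := by
    intro e
    simp only [g, not_lt.mpr (hw e).2.le, if_false]
    split_ifs with h
    · rw [hcomp e h]; ring
    · ring
  have hgexp : ∀ e t, Complex.exp (g e t) = Complex.exp (l e t) := by
    intro e t
    have e1 : Complex.exp (l e t - l e 0 + lam (ends e).1) = Complex.exp (l e t) := by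
      rw [Complex.exp_add, Complex.exp_sub, hsrc, div_mul_cancel₀ _ (Complex.exp_ne_zero _)]
    have e2 : Complex.exp (l e t - l e 1 + lam (ends e).2) = Complex.exp (l e t) := by
      rw [Complex.exp_add, Complex.exp_sub, htgt, div_mul_cancel₀ _ (Complex.exp_ne_zero _)]
    simp only [g]
    split_ifs <;> assumption
  let S : E → Set ℝ := fun e => Icc 0 1 ∩ emb.arc e ⁻¹' frontier T
  have hSc : ∀ e, IsCompact (S e) := fun e =>
    isCompact_Icc.of_isClosed_subset
      ((emb.arc_cont e).preimage_isClosed_of_isClosed isClosed_Icc isClosed_frontier)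
      inter_subset_left
  have hgc : ∀ e, ContinuousOn (g e) (S e) := by
    intro e
    have c1 : ContinuousOn (fun t => l e t - l e 0 + lam (ends e).1) (S e) :=
      (((hlc e).mono inter_subset_left).sub continuousOn_const).add continuousOn_const
    have c2 : ContinuousOn (fun t => l e t - l e 1 + lam (ends e).2) (S e) :=
      (((hlc e).mono inter_subset_left).sub continuousOn_const).add continuousOn_const
    by_cases h : emb.arc e '' Ioo 0 1 ⊆ frontier T
    · simpa only [g, if_pos h] using c1
    · have hwS : w e ∉ S e := fun hws => hw' e h hws.2
      simp only [g, if_neg h]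
      refine ContinuousOn.if ?_ ?_ ?_
      · rintro a ⟨haS, ha⟩
        have : a = w e := by
          have := frontier_lt_subset_eq continuous_id continuous_const ha
          exact this
        exact absurd (this ▸ haS) hwS
      · exact c1.mono inter_subset_left
      · exact c2.mono inter_subset_left
  have : ∀ e, CompactSpace (S e) := fun e => isCompact_iff_compactSpace.mp (hSc e)
  let π : (Σ e, S e) → frontier T := fun x => ⟨emb.arc x.1 x.2, x.2.2.2⟩
  have hπ : Continuous π := by
    refine Continuous.subtype_mk (continuous_sigma fun e => ?_) _
    exact (emb.arc_cont e).comp_continuous continuous_subtype_val (fun x => x.2.1)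
  have hsurj : Function.Surjective π := by
    rintro ⟨x, hx⟩
    rcases hfr hx with ⟨v, rfl⟩ | h
    · obtain ⟨e, rfl | rfl⟩ := hV v
      · exact ⟨⟨e, 0, h0, by rw [mem_preimage, emb.arc_src]; exact hx⟩, Subtype.ext (emb.arc_src e)⟩
      · exact ⟨⟨e, 1, h1, by rw [mem_preimage, emb.arc_tgt]; exact hx⟩, Subtype.ext (emb.arc_tgt e)⟩
    · obtain ⟨e, t, ht, rfl⟩ := mem_iUnion.mp h
      exact ⟨⟨e, t, ht, hx⟩, rfl⟩
  have hquot : IsQuotientMap π := hπ.isClosedMap.isQuotientMap hπ hsurj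
  let gg : C((Σ e, S e), ℂ) := ⟨fun x => g x.1 x.2, continuous_sigma fun e =>
    (hgc e).comp_continuous continuous_subtype_val (fun x => x.2)⟩
  have hend : ∀ e, ∀ t ∈ Icc (0:ℝ) 1, t ∈ Ioo (0:ℝ) 1 ∨ ∃ v, emb.arc e t = emb.vpos v ∧ g e t = lam v := by
    intro e t ht
    rcases icc_cases ht with rfl | rfl | h
    · exact Or.inr ⟨_, emb.arc_src e, hg0 e⟩
    · exact Or.inr ⟨_, emb.arc_tgt e, hg1 e⟩
    · exact Or.inl h
  have hfib : ∀ x y, π x = π y → gg x = gg y := by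
    rintro ⟨e, t, ht⟩ ⟨e', t', ht'⟩ hxy
    have hxy' : emb.arc e t = emb.arc e' t' := congrArg Subtype.val hxy
    change g e t = g e' t'
    rcases hend e t ht.1 with h | ⟨v, hv, hgv⟩ <;> rcases hend e' t' ht'.1 with h' | ⟨v', hv', hgv'⟩
    · by_cases hee : e = e'
      · subst hee
        rw [emb.arc_injOn e h h' hxy']
      · exact absurd ⟨t', h', hxy'.symm⟩
          (disjoint_left.mp (emb.arc_disjoint e e' hee) ⟨t, h, rfl⟩)
    · exact absurd ⟨t, h, hxy'.trans hv'⟩ (emb.arc_avoid e v')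
    · exact absurd ⟨t', h', hxy'.symm.trans hv⟩ (emb.arc_avoid e' v)
    · have := emb.vinj (hv.symm.trans (hxy'.trans hv'))
      rw [hgv, hgv', this]
  have hq' : q ∉ closure T := by
    intro hqc
    by_cases h : q ∈ frontier T
    · exact hq (hfr h)
    · apply h
      refine ⟨hqc, ?_⟩
      rw [(face_isOpen emb hT.1).interior_eq]
      exact hqT
  let πc : C((Σ e, S e), frontier T) := ⟨π, hπ⟩
  have hquot' : IsQuotientMap πc := hquot
  have hfib' : Function.FactorsThrough gg πc := fun x y h => hfib x y h
  refine no_log_frontier T hT.2 p q hp hq' (hquot'.lift gg hfib') ?_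
  intro z
  obtain ⟨⟨e, t, ht⟩, rfl⟩ := hsurj z
  have h3 : (hquot'.lift gg hfib') (π ⟨e, t, ht⟩) = gg ⟨e, t, ht⟩ :=
    congrArg (fun f : C((Σ e, S e), ℂ) => f ⟨e, t, ht⟩) (hquot'.lift_comp gg hfib')
  rw [h3]
  change phi (emb.arc e t) - phi p = (phi (emb.arc e t) - phi q) * Complex.exp (g e t)
  rw [hgexp]
  exact hl e t ht.1

lemma exists_edge_logs (emb : PlaneEmbedding V E ends) {p q : ℝ × ℝ} (hp : p ∉ emb.image)
    (hq : q ∉ emb.image) :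
    ∃ l : E → ℝ → ℂ, (∀ e, ContinuousOn (l e) (Icc 0 1)) ∧ ∀ e, ∀ t ∈ Icc (0:ℝ) 1,
      phi (emb.arc e t) - phi p = (phi (emb.arc e t) - phi q) * Complex.exp (l e t) := by
  have hne : ∀ r ∉ emb.image, ∀ e, ∀ t ∈ Icc (0:ℝ) 1, phi (emb.arc e t) - phi r ≠ 0 := by
    intro r hr e t ht h0
    exact hr (phi.injective (sub_eq_zero.mp h0) ▸ arc_mem_image emb e ht)
  have : ∀ e, ∃ l : ℝ → ℂ, ContinuousOn l (Icc 0 1) ∧ ∀ t ∈ Icc (0:ℝ) 1,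
      phi (emb.arc e t) - phi p = (phi (emb.arc e t) - phi q) * Complex.exp (l t) := by
    intro e
    have hc : ContinuousOn (fun t => phi (emb.arc e t)) (Icc 0 1) :=
      phi.continuous.comp_continuousOn (emb.arc_cont e)
    obtain ⟨G, hG, hG'⟩ := exists_log_path
      (fun t => (phi (emb.arc e t) - phi p) / (phi (emb.arc e t) - phi q))
      (ContinuousOn.div (hc.sub continuousOn_const) (hc.sub continuousOn_const) (hne q hq e))
      (fun t ht => div_ne_zero (hne p hp e t ht) (hne q hq e t ht))
    refine ⟨G, hG, fun t ht => ?_⟩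
    rw [hG' t ht, mul_div_cancel₀ _ (hne q hq e t ht)]
  choose l hl using this
  exact ⟨l, fun e => (hl e).1, fun e => (hl e).2⟩

lemma exists_vertex_log (emb : PlaneEmbedding V E ends) {p q : ℝ × ℝ} (hp : p ∉ emb.image)
    (hq : q ∉ emb.image) (v : V) :
    ∃ a : ℂ, phi (emb.vpos v) - phi p = (phi (emb.vpos v) - phi q) * Complex.exp a := by
  have hne : ∀ r ∉ emb.image, phi (emb.vpos v) - phi r ≠ 0 := by
    intro r hr h0
    exact hr (phi.injective (sub_eq_zero.mp h0) ▸ vpos_mem_image emb v)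
  refine ⟨Complex.log ((phi (emb.vpos v) - phi p) / (phi (emb.vpos v) - phi q)), ?_⟩
  rw [Complex.exp_log (div_ne_zero (hne p hp) (hne q hq)), mul_div_cancel₀ _ (hne q hq)]

lemma exists_potential (emb : PlaneEmbedding V E ends) (e₀ : E)
    (hV : ∀ v, ∃ e, e ≠ e₀ ∧ ((ends e).1 = v ∨ (ends e).2 = v)) {p q z₀ : ℝ × ℝ} {r : ℝ}
    (hq : q ∉ emb.image)
    (hr : ∀ e ≠ e₀, ∀ t ∈ Icc (0:ℝ) 1, r ≤ ‖phi (emb.arc e t) - phi z₀‖)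
    (hpr : ‖phi p - phi z₀‖ < r) (hqr : ‖phi q - phi z₀‖ < r)
    (l : E → ℝ → ℂ) (hlc : ∀ e, ContinuousOn (l e) (Icc 0 1))
    (hl : ∀ e, ∀ t ∈ Icc (0:ℝ) 1,
      phi (emb.arc e t) - phi p = (phi (emb.arc e t) - phi q) * Complex.exp (l e t)) :
    ∃ lam : V → ℂ,
      (∀ v, phi (emb.vpos v) - phi p = (phi (emb.vpos v) - phi q) * Complex.exp (lam v)) ∧
      ∀ e ≠ e₀, l e 1 - l e 0 = lam (ends e).2 - lam (ends e).1 := by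
  let g : ℂ → ℂ := fun z => Complex.log ((z - phi p) / (z - phi z₀)) -
    Complex.log ((z - phi q) / (z - phi z₀))
  have hslit : ∀ s z : ℂ, ‖s - phi z₀‖ < r → r ≤ ‖z - phi z₀‖ →
      (z - s) / (z - phi z₀) ∈ Complex.slitPlane := by
    intro s z hs hz
    apply mem_slit
    rw [sub_sub_sub_cancel_left, norm_sub_rev]
    linarith
  have hgexp : ∀ z : ℂ, r ≤ ‖z - phi z₀‖ →
      z - phi p = (z - phi q) * Complex.exp (g z) := by
    intro z hz
    have h1 := Complex.slitPlane_ne_zero (hslit _ z hpr hz)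
    have h2 := Complex.slitPlane_ne_zero (hslit _ z hqr hz)
    simp only [g]
    rw [Complex.exp_sub, Complex.exp_log h1, Complex.exp_log h2]
    have h3 := (div_ne_zero_iff.mp h1)
    have h4 := (div_ne_zero_iff.mp h2)
    have h5 := h3.1
    have h6 := h3.2
    have h7 := h4.1
    field_simp
  have hgc : ContinuousOn g {z | r ≤ ‖z - phi z₀‖} := by
    refine ContinuousOn.sub (ContinuousOn.clog (ContinuousOn.div (by fun_prop) (by fun_prop) ?_) ?_)
      (ContinuousOn.clog (ContinuousOn.div (by fun_prop) (by fun_prop) ?_) ?_)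
    · intro z hz
      exact (div_ne_zero_iff.mp (Complex.slitPlane_ne_zero (hslit _ z hpr hz))).2
    · intro z hz
      exact hslit _ z hpr hz
    · intro z hz
      exact (div_ne_zero_iff.mp (Complex.slitPlane_ne_zero (hslit _ z hpr hz))).2
    · intro z hz
      exact hslit _ z hqr hz
  have h0 : (0:ℝ) ∈ Icc (0:ℝ) 1 := by simp
  have h1 : (1:ℝ) ∈ Icc (0:ℝ) 1 := by simp
  refine ⟨fun v => g (phi (emb.vpos v)), fun v => hgexp _ ?_, fun e he => ?_⟩
  · obtain ⟨e, he, rfl | rfl⟩ := hV v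
    · rw [← emb.arc_src]; exact hr e he 0 h0
    · rw [← emb.arc_tgt]; exact hr e he 1 h1
  · have hc : ContinuousOn (fun t => g (phi (emb.arc e t)) - l e t) (Icc 0 1) := by
      refine ContinuousOn.sub ?_ (hlc e)
      exact hgc.comp (phi.continuous.comp_continuousOn (emb.arc_cont e)) (fun t ht => hr e he t ht)
    have := exp_eq_one_const isPreconnected_Icc hc (fun t ht => by
      rw [Complex.exp_sub, div_eq_one_iff_eq (Complex.exp_ne_zero _)]
      have hne : phi (emb.arc e t) - phi q ≠ 0 := fun hz =>
        hq (phi.injective (sub_eq_zero.mp hz) ▸ arc_mem_image emb e ht)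
      exact mul_left_cancel₀ hne ((hgexp _ (hr e he t ht)).symm.trans (hl e t ht))) h0 h1
    change l e 1 - l e 0 = g (phi (emb.vpos (ends e).2)) - g (phi (emb.vpos (ends e).1))
    rw [← emb.arc_src, ← emb.arc_tgt]
    linear_combination this

end General

lemma separation (γ : ℝ → ℂ) (hc : ContinuousOn γ (Icc 0 1)) (hi : InjOn γ (Icc 0 1))
    (N : Set ℂ) (hN : IsClosed N) (hdisj : ∀ t ∈ Ioo (0:ℝ) 1, γ t ∉ N) (h0 : γ 0 ∈ N) (h1 : γ 1 ∈ N)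
    (LN : ℂ → ℂ) (hLN : ContinuousOn LN Nᶜ)
    (hLN' : ∀ z ∈ Nᶜ, z - γ 1 = (z - γ 0) * Complex.exp (LN z)) :
    ∃ (c : ℂ) (r : ℝ) (p q : ℂ), 0 < r ∧ Metric.ball c r ⊆ Nᶜ ∧ p ∈ Metric.ball c r ∧
      q ∈ Metric.ball c r ∧ p ∉ γ '' Icc 0 1 ∧ q ∉ γ '' Icc 0 1 ∧
      ∀ S : Set ℂ, IsPreconnected S → S ⊆ (N ∪ γ '' Icc 0 1)ᶜ → p ∈ S → q ∈ S → False := by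
  classical
  by_contra hcon
  push Not at hcon
  obtain ⟨Le, hLe, hLe'⟩ := exists_log_compl_arc γ hc
  have hA : IsClosed (γ '' Icc 0 1) := (isCompact_Icc.image_of_continuousOn hc).isClosed
  have hm0 : (0:ℝ) ∈ Icc (0:ℝ) 1 := by simp
  have hm1 : (1:ℝ) ∈ Icc (0:ℝ) 1 := by simp
  have hDexp : ∀ z, z ∉ N → z ∉ γ '' Icc 0 1 → Complex.exp (Le z - LN z) = 1 := by
    intro z hzN hzA
    rw [Complex.exp_sub, div_eq_one_iff_eq (Complex.exp_ne_zero _)]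
    have hne : z - γ 0 ≠ 0 := fun h => hzA ⟨0, hm0, (sub_eq_zero.mp h).symm⟩
    exact mul_left_cancel₀ hne ((hLe' z hzA).symm.trans (hLN' z hzN))
  have hD : ∀ (c : ℂ) (r : ℝ) (p q : ℂ), 0 < r → Metric.ball c r ⊆ Nᶜ → p ∈ Metric.ball c r →
      q ∈ Metric.ball c r → p ∉ γ '' Icc 0 1 → q ∉ γ '' Icc 0 1 →
      Le p - LN p = Le q - LN q := by
    intro c r p q hr hb hp hq hpA hqA
    obtain ⟨S, hS, hSs, hpS, hqS, -⟩ := hcon c r p q hr hb hp hq hpA hqA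
    have hs1 : S ⊆ (γ '' Icc 0 1)ᶜ := fun z hz hz' => hSs hz (Or.inr hz')
    have hs2 : S ⊆ Nᶜ := fun z hz hz' => hSs hz (Or.inl hz')
    exact exp_eq_one_const hS (f := fun z => Le z - LN z) ((hLe.mono hs1).sub (hLN.mono hs2))
      (fun z hz => hDexp z (hs2 hz) (hs1 hz)) hpS hqS
  have hne : ∀ (c : ℂ) (r : ℝ), 0 < r → Metric.ball c r ⊆ Nᶜ →
      ∃ w ∈ Metric.ball c r, w ∉ γ '' Icc 0 1 := by
    intro c r hr hb
    by_contra hno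
    push Not at hno
    refine arc_no_ball γ hc hi c r hr ?_
    intro z hz
    obtain ⟨t, ht, rfl⟩ := hno z hz
    rcases icc_cases ht with rfl | rfl | h
    · exact absurd h0 (hb hz)
    · exact absurd h1 (hb hz)
    · exact ⟨t, h, rfl⟩
  have hex : ∀ z, ∃ (ρ : ℝ) (w : ℂ), z ∉ N → 0 < ρ ∧ Metric.ball z ρ ⊆ Nᶜ ∧ w ∈ Metric.ball z ρ ∧
      w ∉ γ '' Icc 0 1 := by
    intro z
    by_cases hz : z ∈ N
    · exact ⟨0, 0, fun h => absurd hz h⟩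
    · obtain ⟨ρ, hρ, hb⟩ := Metric.isOpen_iff.mp hN.isOpen_compl z hz
      obtain ⟨w, hw, hw'⟩ := hne z ρ hρ hb
      exact ⟨ρ, w, fun _ => ⟨hρ, hb, hw, hw'⟩⟩
  choose ρ w hρw using hex
  let n : ℂ → ℂ := fun z => Le (w z) - LN (w z)
  have hnD : ∀ z, z ∉ N → z ∉ γ '' Icc 0 1 → n z = Le z - LN z := by
    intro z hzN hzA
    obtain ⟨h1, h2, h3, h4⟩ := hρw z hzN
    exact hD z (ρ z) _ _ h1 h2 h3 (Metric.mem_ball_self h1) h4 hzA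
  have hnexp : ∀ z, z ∉ N → Complex.exp (n z) = 1 := by
    intro z hzN
    obtain ⟨h1, h2, h3, h4⟩ := hρw z hzN
    exact hDexp _ (h2 h3) h4
  have hnloc : ∀ z, z ∉ N → ∀ y ∈ Metric.ball z (ρ z), n y = n z := by
    intro z hzN y hy
    obtain ⟨h1, h2, h3, h4⟩ := hρw z hzN
    obtain ⟨k1, k2, k3, k4⟩ := hρw y (h2 hy)
    have hpos : 0 < min (ρ y) (ρ z - dist y z) := lt_min k1 (sub_pos.mpr hy)
    have hs : Metric.ball y (min (ρ y) (ρ z - dist y z)) ⊆ Metric.ball y (ρ y) :=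
      Metric.ball_subset_ball (min_le_left _ _)
    have hs' : Metric.ball y (min (ρ y) (ρ z - dist y z)) ⊆ Metric.ball z (ρ z) :=
      Metric.ball_subset_ball' (by linarith [min_le_right (ρ y) (ρ z - dist y z)])
    obtain ⟨u, hu, hu'⟩ := hne y _ hpos (hs.trans k2)
    exact (hD y (ρ y) _ _ k1 k2 k3 (hs hu) k4 hu').trans (hD z (ρ z) _ _ h1 h2 (hs' hu) h3 hu' h4)
  let G : ℂ → ℂ := fun z => if z ∈ N then Le z else LN z + n z
  have hG1 : ∀ z, z ∉ γ '' Icc 0 1 → G z = Le z := by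
    intro z hz
    by_cases hzN : z ∈ N
    · simp only [G, if_pos hzN]
    · simp only [G, if_neg hzN]
      rw [hnD z hzN hz]; ring
  have hNA : ∀ z ∈ ({γ 0, γ 1}ᶜ : Set ℂ), z ∈ N → z ∉ γ '' Icc 0 1 := by
    rintro z hz hzN ⟨t, ht, rfl⟩
    simp only [mem_compl_iff, mem_insert_iff, mem_singleton_iff, not_or] at hz
    rcases icc_cases ht with rfl | rfl | h
    · exact hz.1 rfl
    · exact hz.2 rfl
    · exact hdisj t h hzN
  have h01 : γ 0 ≠ γ 1 := fun h => by
    have := hi hm0 hm1 h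
    norm_num at this
  refine no_log_two (γ 0) (γ 1) h01 G ?_ ?_
  · intro z hz
    apply ContinuousAt.continuousWithinAt
    by_cases hzN : z ∈ N
    · have hzA := hNA z hz hzN
      have hnh := hA.isOpen_compl.mem_nhds hzA
      refine (hLe.continuousAt hnh).congr ?_
      filter_upwards [hnh] with y hy
      exact (hG1 y hy).symm
    · obtain ⟨h1, h2, h3, h4⟩ := hρw z hzN
      have hnh := hN.isOpen_compl.mem_nhds hzN
      refine ((hLN.continuousAt hnh).add (continuousAt_const (y := n z))).congr ?_
      filter_upwards [Metric.ball_mem_nhds z h1] with y hy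
      have hyN : y ∉ N := h2 hy
      simp only [G, if_neg hyN, hnloc z hzN y hy, Pi.add_apply]
  · intro z hz
    by_cases hzN : z ∈ N
    · have hzA := hNA z hz hzN
      rw [hG1 z hzA]
      exact hLe' z hzA
    · simp only [G, if_neg hzN]
      rw [Complex.exp_add, hnexp z hzN, mul_one]
      exact hLN' z hzN

section Sep

variable {V E : Type} {ends : E → V × V}

/-- The union of all arcs but `e₀`, in the complex plane. -/
def rest (emb : PlaneEmbedding V E ends) (e₀ : E) : Set ℂ :=
  ⋃ e : {e : E // e ≠ e₀}, (fun t => phi (emb.arc e t)) '' Icc 0 1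

/-- Two vertices whose difference quotient has a logarithm off the other arcs. -/
def Rel (emb : PlaneEmbedding V E ends) (e₀ : E) (u v : V) : Prop :=
  ∃ L : ℂ → ℂ, ContinuousOn L (rest emb e₀)ᶜ ∧ ∀ z ∈ (rest emb e₀)ᶜ,
    z - phi (emb.vpos v) = (z - phi (emb.vpos u)) * Complex.exp (L z)

lemma Rel.trans {emb : PlaneEmbedding V E ends} {e₀ : E} {u v w : V} (h : Rel emb e₀ u v)
    (h' : Rel emb e₀ v w) : Rel emb e₀ u w := by
  obtain ⟨L, hL, hL'⟩ := h
  obtain ⟨M, hM, hM'⟩ := h'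
  refine ⟨fun z => L z + M z, hL.add hM, fun z hz => ?_⟩
  rw [hM' z hz, hL' z hz, Complex.exp_add]; ring

lemma Rel.symm {emb : PlaneEmbedding V E ends} {e₀ : E} {u v : V} (h : Rel emb e₀ u v) :
    Rel emb e₀ v u := by
  obtain ⟨L, hL, hL'⟩ := h
  refine ⟨fun z => - L z, hL.neg, fun z hz => ?_⟩
  rw [hL' z hz, mul_assoc, ← Complex.exp_add]; simp

lemma Rel.edge (emb : PlaneEmbedding V E ends) {e₀ e : E} (he : e ≠ e₀) :
    Rel emb e₀ (ends e).1 (ends e).2 := by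
  obtain ⟨L, hL, hL'⟩ := exists_log_compl_arc (fun t => phi (emb.arc e t))
    (phi.continuous.comp_continuousOn (emb.arc_cont e))
  have hs : (rest emb e₀)ᶜ ⊆ ((fun t => phi (emb.arc e t)) '' Icc 0 1)ᶜ :=
    compl_subset_compl.mpr (subset_iUnion
      (fun e : {e : E // e ≠ e₀} => (fun t => phi (emb.arc e t)) '' Icc 0 1) ⟨e, he⟩)
  refine ⟨L, hL.mono hs, fun z hz => ?_⟩
  have := hL' z (hs hz)
  simpa only [emb.arc_src, emb.arc_tgt] using this

lemma exists_sides [Finite V] [Finite E] (emb : PlaneEmbedding V E ends) (e₀ : E)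
    (hV : ∀ v, ∃ e, e ≠ e₀ ∧ ((ends e).1 = v ∨ (ends e).2 = v))
    (hne : (ends e₀).1 ≠ (ends e₀).2) (hrel : Rel emb e₀ (ends e₀).1 (ends e₀).2) :
    ∃ (z₀ : ℝ × ℝ) (r : ℝ) (p q : ℝ × ℝ),
      (∀ e ≠ e₀, ∀ t ∈ Icc (0:ℝ) 1, r ≤ ‖phi (emb.arc e t) - phi z₀‖) ∧
      p ∉ emb.image ∧ q ∉ emb.image ∧ ‖phi p - phi z₀‖ < r ∧ ‖phi q - phi z₀‖ < r ∧
      connectedComponentIn emb.imageᶜ p ≠ connectedComponentIn emb.imageᶜ q := by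
  have hm0 : (0:ℝ) ∈ Icc (0:ℝ) 1 := by simp
  have hm1 : (1:ℝ) ∈ Icc (0:ℝ) 1 := by simp
  have hinj : InjOn (emb.arc e₀) (Icc 0 1) := by
    have hends : ∀ t ∈ Icc (0:ℝ) 1, ∀ v, emb.arc e₀ t = emb.vpos v → t = 0 ∨ t = 1 := by
      intro t ht v hv
      rcases icc_cases ht with h | h | h
      · exact Or.inl h
      · exact Or.inr h
      · exact absurd ⟨t, h, hv⟩ (emb.arc_avoid e₀ v)
    have h01 : emb.arc e₀ 0 ≠ emb.arc e₀ 1 := by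
      rw [emb.arc_src, emb.arc_tgt]
      exact fun h => hne (emb.vinj h)
    intro s hs t ht hst
    rcases icc_cases hs with rfl | rfl | h
    · rcases hends t ht _ (hst.symm.trans (emb.arc_src e₀)) with rfl | rfl
      · rfl
      · exact absurd hst h01
    · rcases hends t ht _ (hst.symm.trans (emb.arc_tgt e₀)) with rfl | rfl
      · exact absurd hst.symm h01
      · rfl
    · rcases icc_cases ht with rfl | rfl | h'
      · exact absurd ⟨s, h, hst.trans (emb.arc_src e₀)⟩ (emb.arc_avoid e₀ _)
      · exact absurd ⟨s, h, hst.trans (emb.arc_tgt e₀)⟩ (emb.arc_avoid e₀ _)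
      · exact emb.arc_injOn e₀ h h' hst
  have hclosed : IsClosed (rest emb e₀) := by
    refine isClosed_iUnion_of_finite fun e => ?_
    exact (isCompact_Icc.image_of_continuousOn
      (phi.continuous.comp_continuousOn (emb.arc_cont e))).isClosed
  have hmem : ∀ v, phi (emb.vpos v) ∈ rest emb e₀ := by
    intro v
    obtain ⟨e, he, rfl | rfl⟩ := hV v
    · exact mem_iUnion.mpr ⟨⟨e, he⟩, 0, hm0, by simp only [emb.arc_src]⟩
    · exact mem_iUnion.mpr ⟨⟨e, he⟩, 1, hm1, by simp only [emb.arc_tgt]⟩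
  obtain ⟨L, hL, hL'⟩ := hrel
  obtain ⟨c, r, p, q, hr, hb, hp, hq, hpA, hqA, hS⟩ := separation (fun t => phi (emb.arc e₀ t))
    (phi.continuous.comp_continuousOn (emb.arc_cont e₀))
    (fun s hs t ht h => hinj hs ht (phi.injective h)) (rest emb e₀) hclosed
    (by
      rintro t ht h
      obtain ⟨⟨e, he⟩, s, hs, hst⟩ := mem_iUnion.mp h
      have hst' : emb.arc e s = emb.arc e₀ t := phi.injective hst
      rcases icc_cases hs with rfl | rfl | h'
      · exact emb.arc_avoid e₀ _ ⟨t, ht, hst'.symm.trans (emb.arc_src e)⟩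
      · exact emb.arc_avoid e₀ _ ⟨t, ht, hst'.symm.trans (emb.arc_tgt e)⟩
      · exact disjoint_left.mp (emb.arc_disjoint e e₀ he) ⟨s, h', hst'⟩ ⟨t, ht, rfl⟩)
    (by simp only [emb.arc_src]; exact hmem _) (by simp only [emb.arc_tgt]; exact hmem _) L hL
    (by simpa only [emb.arc_src, emb.arc_tgt] using hL')
  have himg : ∀ x : ℝ × ℝ, x ∈ emb.image ↔
      phi x ∈ rest emb e₀ ∪ (fun t => phi (emb.arc e₀ t)) '' Icc 0 1 := by
    intro x
    constructor
    · rintro (⟨v, rfl⟩ | h)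
      · exact Or.inl (hmem v)
      · obtain ⟨e, t, ht, rfl⟩ := mem_iUnion.mp h
        by_cases he : e = e₀
        · subst he; exact Or.inr ⟨t, ht, rfl⟩
        · exact Or.inl (mem_iUnion.mpr ⟨⟨e, he⟩, t, ht, rfl⟩)
    · rintro (h | ⟨t, ht, h⟩)
      · obtain ⟨⟨e, he⟩, t, ht, h⟩ := mem_iUnion.mp h
        exact phi.injective h ▸ arc_mem_image emb e ht
      · exact phi.injective h ▸ arc_mem_image emb e₀ ht
  have hpi : phi.symm p ∉ emb.image := by
    rw [himg, phi.apply_symm_apply]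
    rintro (h | h)
    · exact hb hp h
    · exact hpA h
  have hqi : phi.symm q ∉ emb.image := by
    rw [himg, phi.apply_symm_apply]
    rintro (h | h)
    · exact hb hq h
    · exact hqA h
  refine ⟨phi.symm c, r, phi.symm p, phi.symm q, ?_, hpi, hqi, ?_, ?_, ?_⟩
  · intro e he t ht
    rw [phi.apply_symm_apply]
    by_contra hlt
    refine hb (a := phi (emb.arc e t)) ?_ (mem_iUnion.mpr ⟨⟨e, he⟩, t, ht, rfl⟩)
    rw [Metric.mem_ball, dist_eq_norm]
    exact not_le.mp hlt
  · simpa only [phi.apply_symm_apply, Metric.mem_ball, dist_eq_norm] using hp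
  · simpa only [phi.apply_symm_apply, Metric.mem_ball, dist_eq_norm] using hq
  · intro heq
    refine hS (phi '' connectedComponentIn emb.imageᶜ (phi.symm p))
      (isPreconnected_connectedComponentIn.image _ phi.continuous.continuousOn) ?_
      ⟨phi.symm p, mem_connectedComponentIn hpi, phi.apply_symm_apply p⟩
      ⟨phi.symm q, by rw [heq]; exact mem_connectedComponentIn hqi, phi.apply_symm_apply q⟩
    rintro _ ⟨x, hx, rfl⟩ hx'
    exact connectedComponentIn_subset _ _ hx ((himg x).mpr hx')

end Sep

/-- The added connecting edge. -/
abbrev loopE (m : ℕ) : LoopedChainE m := .inr (.inr (.inr (.inr ())))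

lemma hV_chain (m : ℕ) (c : Fin (m + 1) → Bool) (v : LoopedChainV m) :
    ∃ e, e ≠ loopE m ∧ ((loopedChainEnds m c e).1 = v ∨ (loopedChainEnds m c e).2 = v) := by
  rcases v with ⟨j, b⟩ | b
  · cases b
    · exact ⟨.inl j, by simp, Or.inl rfl⟩
    · exact ⟨.inl j, by simp, Or.inr rfl⟩
  · cases b
    · exact ⟨.inr (.inr (.inl true)), by simp, Or.inl rfl⟩
    · exact ⟨.inr (.inr (.inr (.inl true))), by simp, Or.inl rfl⟩

lemma rel_chain (m : ℕ) (c : Fin (m + 1) → Bool)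
    (emb : PlaneEmbedding (LoopedChainV m) (LoopedChainE m) (loopedChainEnds m c)) :
    Rel emb (loopE m) (.inr false) (.inr true) := by
  have hjoint : ∀ j x, Rel emb (loopE m) (.inr false) (.inl (j, x)) →
      ∀ b, Rel emb (loopE m) (.inr false) (.inl (j, b)) := by
    intro j x h b
    have he : Rel emb (loopE m) (.inl (j, false)) (.inl (j, true)) :=
      Rel.edge emb (e := .inl j) (by simp)
    cases x <;> cases b
    · exact h
    · exact h.trans he
    · exact h.trans he.symm
    · exact h
  have hall : ∀ j, ∀ b, Rel emb (loopE m) (.inr false) (.inl (j, b)) := by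
    intro j
    induction j using Fin.induction with
    | zero => exact hjoint _ _ (Rel.edge emb (e := .inr (.inr (.inl true))) (by simp))
    | succ i ih =>
      exact hjoint _ _ ((ih _).trans (Rel.edge emb (e := .inr (.inl (i, true))) (by simp)))
  exact (hall _ _).trans (Rel.edge emb (e := .inr (.inr (.inr (.inl true)))) (by simp)).symm

/-- Position of a vertex along the chain. -/
def pos (m : ℕ) : LoopedChainV m → ℕ
  | .inl (j, _) => j + 1
  | .inr false => 0
  | .inr true => m + 2

lemma tree_potential (m : ℕ) (c : Fin (m + 1) → Bool)
    (emb : PlaneEmbedding (LoopedChainV m) (LoopedChainE m) (loopedChainEnds m c))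
    {p q : ℝ × ℝ} (hp : p ∉ emb.image) (hq : q ∉ emb.image)
    (l : LoopedChainE m → ℝ → ℂ)
    (hl : ∀ e, ∀ t ∈ Icc (0:ℝ) 1,
      phi (emb.arc e t) - phi p = (phi (emb.arc e t) - phi q) * Complex.exp (l e t))
    (s : Fin m → Bool) (sa sc : Bool) :
    ∃ lam : LoopedChainV m → ℂ,
      (∀ v, phi (emb.vpos v) - phi p = (phi (emb.vpos v) - phi q) * Complex.exp (lam v)) ∧
      ∀ e, e ≠ loopE m → e ≠ .inr (.inr (.inl sa)) → (∀ k, e ≠ .inr (.inl (k, s k))) →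
        e ≠ .inr (.inr (.inr (.inl sc))) →
        l e 1 - l e 0 = lam (loopedChainEnds m c e).2 - lam (loopedChainEnds m c e).1 := by
  have hm0 : (0:ℝ) ∈ Icc (0:ℝ) 1 := by simp
  have hm1 : (1:ℝ) ∈ Icc (0:ℝ) 1 := by simp
  let P : LoopedChainV m → ℂ → Prop := fun v a =>
    phi (emb.vpos v) - phi p = (phi (emb.vpos v) - phi q) * Complex.exp a
  have hne : ∀ v, phi (emb.vpos v) - phi q ≠ 0 := fun v h =>
    hq (phi.injective (sub_eq_zero.mp h) ▸ vpos_mem_image emb v)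
  let Δ : LoopedChainE m → ℂ := fun e => l e 1 - l e 0
  have hP0 : ∀ e, P (loopedChainEnds m c e).1 (l e 0) := by
    intro e
    have := hl e 0 hm0
    rwa [emb.arc_src] at this
  have hP1 : ∀ e, P (loopedChainEnds m c e).2 (l e 1) := by
    intro e
    have := hl e 1 hm1
    rwa [emb.arc_tgt] at this
  have hPP : ∀ v a b d, P v a → P v b → Complex.exp (d + (a - b)) = Complex.exp d := by
    intro v a b d ha hb
    have := mul_left_cancel₀ (hne v) (ha.symm.trans hb)
    rw [Complex.exp_add, Complex.exp_sub, this, div_self (Complex.exp_ne_zero _), mul_one]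
  have hfwd : ∀ e a, P (loopedChainEnds m c e).1 a → P (loopedChainEnds m c e).2 (a + Δ e) := by
    intro e a ha
    have h1 := hP1 e
    have h2 := hPP _ _ _ (l e 1) ha (hP0 e)
    simp only [P] at h1 ⊢
    rw [h1, ← h2]
    congr 2
    simp only [Δ]; ring
  have hbwd : ∀ e a, P (loopedChainEnds m c e).2 a → P (loopedChainEnds m c e).1 (a - Δ e) := by
    intro e a ha
    have h1 := hP0 e
    have h2 := hPP _ _ _ (l e 0) ha (hP1 e)
    simp only [P] at h1 ⊢
    rw [h1, ← h2]
    congr 2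
    simp only [Δ]; ring
  let val : Fin (m + 1) → ℂ → Bool → ℂ := fun j y b => if b then y + Δ (.inl j) else y
  let base : Fin (m + 1) → Bool → ℂ → ℂ := fun j x a => if x then a - Δ (.inl j) else a
  have hvb : ∀ j x a, val j (base j x a) x = a := by
    intro j x a
    cases x <;> simp [val, base]
  have hval : ∀ j y b, P (.inl (j, false)) y → P (.inl (j, b)) (val j y b) := by
    intro j y b h
    cases b
    · simpa [val] using h
    · exact hfwd (.inl j) y h
  have hbase : ∀ j x a, P (.inl (j, x)) a → P (.inl (j, false)) (base j x a) := by
    intro j x a h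
    cases x
    · simpa [base] using h
    · exact hbwd (.inl j) a h
  obtain ⟨a0, ha0⟩ := exists_vertex_log emb hp hq (.inl (0, false))
  let f : ∀ i : Fin m, ℂ → ℂ := fun i y =>
    base i.succ (if c i.succ then false else !(s i))
      (val i.castSucc y (if c i.castSucc then true else !(s i)) + Δ (.inr (.inl (i, !(s i)))))
  obtain ⟨μ, hμ0, hμ⟩ : ∃ μ : Fin (m + 1) → ℂ, μ 0 = a0 ∧ ∀ i : Fin m, μ i.succ = f i (μ i.castSucc) :=
    ⟨fun j => Fin.induction (motive := fun _ => ℂ) a0 f j, rfl, fun i => Fin.induction_succ _ _ _⟩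
  have hPμ : ∀ j, P (.inl (j, false)) (μ j) := by
    intro j
    induction j using Fin.induction with
    | zero => rw [hμ0]; exact ha0
    | succ i ih =>
      rw [hμ]
      exact hbase _ _ _ (hfwd (.inr (.inl (i, !(s i)))) _ (hval _ _ _ ih))
  let L : Fin (m + 1) → Bool → ℂ := fun j b => val j (μ j) b
  have hPL : ∀ j b, P (.inl (j, b)) (L j b) := fun j b => hval _ _ _ (hPμ j)
  let lam : LoopedChainV m → ℂ := fun v => match v with
    | .inl (j, b) => L j b
    | .inr false => L 0 (if c 0 then false else !sa) - Δ (.inr (.inr (.inl (!sa))))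
    | .inr true => L (Fin.last m) (if c (Fin.last m) then true else !sc) -
        Δ (.inr (.inr (.inr (.inl (!sc)))))
  refine ⟨lam, ?_, ?_⟩
  · rintro (⟨j, b⟩ | b)
    · exact hPL j b
    · cases b
      · exact hbwd (.inr (.inr (.inl (!sa)))) _ (hPL _ _)
      · exact hbwd (.inr (.inr (.inr (.inl (!sc))))) _ (hPL _ _)
  · rintro (j | ⟨k, t⟩ | t | t | u) h1 h2 h3 h4
    · change Δ (.inl j) = L j true - L j false
      simp [L, val]
    · have ht : t = !(s k) := by
        have : t ≠ s k := fun h => h3 k (by rw [h])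
        revert this; cases t <;> cases s k <;> simp
      subst ht
      change Δ (.inr (.inl (k, !(s k)))) = L k.succ (if c k.succ then false else !(s k)) -
        L k.castSucc (if c k.castSucc then true else !(s k))
      have : L k.succ (if c k.succ then false else !(s k)) =
          val k.castSucc (μ k.castSucc) (if c k.castSucc then true else !(s k)) +
            Δ (.inr (.inl (k, !(s k)))) := by
        simp only [L]
        rw [hμ k]
        exact hvb _ _ _
      rw [this]
      simp only [L]; ring
    · have ht : t = !sa := by
        have : t ≠ sa := fun h => h2 (by rw [h])
        revert this; cases t <;> cases sa <;> simp
      subst ht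
      change Δ (.inr (.inr (.inl (!sa)))) = L 0 (if c 0 then false else !sa) -
        (L 0 (if c 0 then false else !sa) - Δ (.inr (.inr (.inl (!sa)))))
      ring
    · have ht : t = !sc := by
        have : t ≠ sc := fun h => h4 (by rw [h])
        revert this; cases t <;> cases sc <;> simp
      subst ht
      change Δ (.inr (.inr (.inr (.inl (!sc))))) =
        L (Fin.last m) (if c (Fin.last m) then true else !sc) -
        (L (Fin.last m) (if c (Fin.last m) then true else !sc) - Δ (.inr (.inr (.inr (.inl (!sc))))))
      ring
    · exact absurd rfl h1

lemma crossing (m : ℕ) (c : Fin (m + 1) → Bool)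
    (emb : PlaneEmbedding (LoopedChainV m) (LoopedChainE m) (loopedChainEnds m c))
    {p q z₀ : ℝ × ℝ} {r : ℝ} (hp : p ∉ emb.image) (hq : q ∉ emb.image)
    (hr : ∀ e ≠ loopE m, ∀ t ∈ Icc (0:ℝ) 1, r ≤ ‖phi (emb.arc e t) - phi z₀‖)
    (hpr : ‖phi p - phi z₀‖ < r) (hqr : ‖phi q - phi z₀‖ < r)
    {T : Set (ℝ × ℝ)} (hT : emb.IsBoundedFace T) (hpT : p ∈ T) (hqT : q ∉ T) :
    emb.arc (loopE m) '' Ioo 0 1 ⊆ frontier T ∧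
    ∀ K < m + 2, ∃ e ≠ loopE m, emb.arc e '' Ioo 0 1 ⊆ frontier T ∧
      ¬ (K < pos m (loopedChainEnds m c e).1 ↔ K < pos m (loopedChainEnds m c e).2) := by
  have hm0 : (0:ℝ) ∈ Icc (0:ℝ) 1 := by simp
  have hm1 : (1:ℝ) ∈ Icc (0:ℝ) 1 := by simp
  have hV' : ∀ v, ∃ e, (loopedChainEnds m c e).1 = v ∨ (loopedChainEnds m c e).2 = v :=
    fun v => let ⟨e, _, h⟩ := hV_chain m c v; ⟨e, h⟩
  obtain ⟨l, hlc, hl⟩ := exists_edge_logs emb hp hq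
  obtain ⟨lam, hlam, hcomp⟩ := exists_potential emb (loopE m) (hV_chain m c) hq hr hpr hqr l hlc hl
  constructor
  · by_contra hno
    refine no_potential emb hV' hT hpT hq hqT l hlc hl lam hlam fun e he => hcomp e ?_
    rintro rfl
    exact hno he
  · intro K hK
    by_contra hno
    push Not at hno
    have hne : ∀ v, phi (emb.vpos v) - phi q ≠ 0 := fun v h =>
      hq (phi.injective (sub_eq_zero.mp h) ▸ vpos_mem_image emb v)
    have e0 : Complex.exp (l (loopE m) 0) = Complex.exp (lam (.inr false)) := by
      have := hl (loopE m) 0 hm0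
      rw [emb.arc_src] at this
      exact mul_left_cancel₀ (hne _) (this.symm.trans (hlam _))
    have e1 : Complex.exp (l (loopE m) 1) = Complex.exp (lam (.inr true)) := by
      have := hl (loopE m) 1 hm1
      rw [emb.arc_tgt] at this
      exact mul_left_cancel₀ (hne _) (this.symm.trans (hlam _))
    set d : ℂ := (l (loopE m) 1 - l (loopE m) 0) - (lam (.inr true) - lam (.inr false)) with hd
    have hexpd : Complex.exp d = 1 := by
      rw [hd, Complex.exp_sub, Complex.exp_sub, Complex.exp_sub, e0, e1]
      exact div_self (div_ne_zero (Complex.exp_ne_zero _) (Complex.exp_ne_zero _))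
    refine no_potential emb hV' hT hpT hq hqT l hlc hl
      (fun v => lam v + if K < pos m v then d else 0) ?_ ?_
    · intro v
      split_ifs
      · rw [Complex.exp_add, hexpd, mul_one]; exact hlam v
      · rw [add_zero]; exact hlam v
    · intro e he
      by_cases hel : e = loopE m
      · subst hel
        change l (loopE m) 1 - l (loopE m) 0 =
          (lam (.inr true) + if K < pos m (.inr true) then d else 0) -
          (lam (.inr false) + if K < pos m (.inr false) then d else 0)
        rw [if_pos (show K < pos m (.inr true) from hK),
          if_neg (show ¬ K < pos m (.inr false) from Nat.not_lt_zero K), hd]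
        ring
      · have h := hno e hel he
        rw [hcomp e hel]
        simp only [h]
        ring

lemma share (m : ℕ) (c : Fin (m + 1) → Bool)
    (emb : PlaneEmbedding (LoopedChainV m) (LoopedChainE m) (loopedChainEnds m c))
    {T : Set (ℝ × ℝ)} (hT : emb.IsBoundedFace T)
    (h0 : emb.arc (loopE m) '' Ioo 0 1 ⊆ frontier T)
    (hK : ∀ K < m + 2, ∃ e ≠ loopE m, emb.arc e '' Ioo 0 1 ⊆ frontier T ∧
      ¬ (K < pos m (loopedChainEnds m c e).1 ↔ K < pos m (loopedChainEnds m c e).2))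
    (F' : Set (ℝ × ℝ)) (hF' : emb.IsBoundedFace F') (hne : F' ≠ T) : emb.SharesEdge T F' := by
  by_contra hno
  have hno' : ∀ e, emb.arc e '' Ioo 0 1 ⊆ frontier T → ¬ emb.arc e '' Ioo 0 1 ⊆ frontier F' :=
    fun e h h' => hno ⟨e, h, h'⟩
  have hV' : ∀ v, ∃ e, (loopedChainEnds m c e).1 = v ∨ (loopedChainEnds m c e).2 = v :=
    fun v => let ⟨e, _, h⟩ := hV_chain m c v; ⟨e, h⟩
  obtain ⟨p', hp', hFp⟩ := hF'.1
  obtain ⟨q', hq', hTq⟩ := hT.1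
  have hpF : p' ∈ F' := hFp ▸ mem_connectedComponentIn hp'
  have hqF : q' ∉ F' := fun h => hne ((face_eq emb hF'.1 h).trans hTq.symm)
  have hsa : ∃ s : Bool, ¬ emb.arc (.inr (.inr (.inl s))) '' Ioo 0 1 ⊆ frontier F' := by
    obtain ⟨e, he, heT, hlev⟩ := hK 0 (by omega)
    rcases e with j | ⟨k, t⟩ | t | t | u
    · exact absurd (by simp [loopedChainEnds, pos]) hlev
    · exact absurd (by simp [loopedChainEnds, pos]) hlev
    · exact ⟨t, hno' _ heT⟩
    · exact absurd (by simp [loopedChainEnds, pos]) hlev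
    · exact absurd rfl he
  have hsc : ∃ s : Bool, ¬ emb.arc (.inr (.inr (.inr (.inl s)))) '' Ioo 0 1 ⊆ frontier F' := by
    obtain ⟨e, he, heT, hlev⟩ := hK (m + 1) (by omega)
    rcases e with j | ⟨k, t⟩ | t | t | u
    · exact absurd (by simp [loopedChainEnds, pos]) hlev
    · refine absurd ?_ hlev
      have := k.2
      simp only [loopedChainEnds, pos, Fin.val_castSucc, Fin.val_succ]
      omega
    · refine absurd ?_ hlev
      simp [loopedChainEnds, pos]
    · exact ⟨t, hno' _ heT⟩
    · exact absurd rfl he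
  have hs : ∀ k : Fin m, ∃ s : Bool, ¬ emb.arc (.inr (.inl (k, s))) '' Ioo 0 1 ⊆ frontier F' := by
    intro k
    have hk := k.2
    obtain ⟨e, he, heT, hlev⟩ := hK (k + 1) (by omega)
    rcases e with j | ⟨k', t⟩ | t | t | u
    · exact absurd (by simp [loopedChainEnds, pos]) hlev
    · have : k' = k := by
        simp only [loopedChainEnds, pos, Fin.val_castSucc, Fin.val_succ] at hlev
        apply Fin.ext
        omega
      subst this
      exact ⟨t, hno' _ heT⟩
    · refine absurd ?_ hlev
      simp [loopedChainEnds, pos]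
    · refine absurd ?_ hlev
      simp only [loopedChainEnds, pos, Fin.val_last]
      omega
    · exact absurd rfl he
  obtain ⟨sa, hsa⟩ := hsa
  obtain ⟨sc, hsc⟩ := hsc
  choose s hs using hs
  obtain ⟨l, hlc, hl⟩ := exists_edge_logs emb hp' hq'
  obtain ⟨lam, hlam, hcomp⟩ := tree_potential m c emb hp' hq' l hl s sa sc
  refine no_potential emb hV' hF' hpF hq' hqF l hlc hl lam hlam fun e he => hcomp e ?_ ?_ ?_ ?_
  · rintro rfl; exact hno' _ h0 he
  · rintro rfl; exact hsa he
  · rintro k rfl; exact hs k he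
  · rintro rfl; exact hsc he

lemma main (m : ℕ) (c : Fin (m + 1) → Bool)
    (emb : PlaneEmbedding (LoopedChainV m) (LoopedChainE m) (loopedChainEnds m c)) :
    ∃ F : Set (ℝ × ℝ), emb.IsBoundedFace F ∧
      ∀ F' : Set (ℝ × ℝ), emb.IsBoundedFace F' → F' ≠ F → emb.SharesEdge F F' := by
  obtain ⟨z₀, r, p, q, hr, hp, hq, hpr, hqr, hne⟩ := exists_sides emb (loopE m) (hV_chain m c)
    (by simp [loopedChainEnds]) (rel_chain m c emb)
  have key : ∀ p q : ℝ × ℝ, p ∉ emb.image → q ∉ emb.image → ‖phi p - phi z₀‖ < r →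
      ‖phi q - phi z₀‖ < r → connectedComponentIn emb.imageᶜ p ≠ connectedComponentIn emb.imageᶜ q →
      Bornology.IsBounded (connectedComponentIn emb.imageᶜ p) →
      ∃ F : Set (ℝ × ℝ), emb.IsBoundedFace F ∧
      ∀ F' : Set (ℝ × ℝ), emb.IsBoundedFace F' → F' ≠ F → emb.SharesEdge F F' := by
    intro p q hp hq hpr hqr hne hb
    have hT : emb.IsBoundedFace (connectedComponentIn emb.imageᶜ p) := ⟨⟨p, hp, rfl⟩, hb⟩
    obtain ⟨h0, hK⟩ := crossing m c emb hp hq hr hpr hqr hT (mem_connectedComponentIn hp)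
      (fun h => hne (connectedComponentIn_eq h))
    exact ⟨_, hT, share m c emb hT h0 hK⟩
  rcases bounded_or_bounded emb.image (isCompact_image emb).isBounded p q hne with hb | hb
  · exact key p q hp hq hpr hqr hne hb
  · exact key q p hq hp hqr hpr hne.symm hb

end LoopedChain

/-- Every looped chain is a big face graph: in any planar embedding of a looped chain
there is a bounded face sharing an edge with every other bounded face. -/
theorem looped_chain_big_face (m : ℕ) (c : Fin (m + 1) → Bool)
    (emb : PlaneEmbedding (LoopedChainV m) (LoopedChainE m) (loopedChainEnds m c)) :
    ∃ F : Set (ℝ × ℝ), emb.IsBoundedFace F ∧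
      ∀ F' : Set (ℝ × ℝ), emb.IsBoundedFace F' → F' ≠ F → emb.SharesEdge F F' := by
  exact LoopedChain.main m c emb
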